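/- arXiv:2109.07098 — 2 statements merged into one kernel-verified Lean document; each statement's English description precedes it below -/
import Mathlib

section
/- Uniform L^∞ bound (Farina): if d ≥ 1, c ∈ ℝ, and U ∈ L³_loc(ℝ^d, ℂ) solves ΔU + ic ∂_{x₂}U + U(1 − |U|²) = 0 on ℝ^d (in the distributional sense), then ‖U‖_{L^∞(ℝ^d)} ≤ 1 + c²/4. -/
open MeasureTheory Filter Metric

noncomputable section

/-- First partial derivative (direction `x₁`), identifying `ℝ²` with `ℂ`. -/
def pd1 (u : ℂ → ℂ) (z : ℂ) : ℂ := fderiv ℝ u z 1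

/-- Second partial derivative (direction `x₂`). -/
def pd2 (u : ℂ → ℂ) (z : ℂ) : ℂ := fderiv ℝ u z Complex.I

/-- Laplacian `Δu`. -/
def lap (u : ℂ → ℂ) (z : ℂ) : ℂ := fderiv ℝ (pd1 u) z 1 + fderiv ℝ (pd2 u) z Complex.I

/-- `|∇u|²`. -/
def gradSq (u : ℂ → ℂ) (z : ℂ) : ℝ := ‖pd1 u z‖ ^ 2 + ‖pd2 u z‖ ^ 2

/-- Ginzburg–Landau energy density. -/
def energyDensity (u : ℂ → ℂ) (z : ℂ) : ℝ :=
  (1 / 2) * gradSq u z + (1 / 4) * (1 - ‖u z‖ ^ 2) ^ 2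

/-- Ginzburg–Landau energy, valued in `[0,∞]`. -/
def energy (u : ℂ → ℂ) : ENNReal := ∫⁻ z : ℂ, ENNReal.ofReal (energyDensity u z)

/-- `E(u)`, real valued. -/
def Efun (u : ℂ → ℂ) : ℝ := (energy u).toReal

/-- The energy space `ℰ`: (smooth) maps with finite Ginzburg–Landau energy. -/
def memE (u : ℂ → ℂ) : Prop := ContDiff ℝ (⊤ : ℕ∞) u ∧ energy u < ⊤

/-- Momentum density `Re(i ∂₂u (conj u − 1))`. -/
def momDensity (u : ℂ → ℂ) (z : ℂ) : ℝ :=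
  (Complex.I * pd2 u z * ((starRingEnd ℂ) (u z) - 1)).re

/-- Integrability of the momentum density. -/
def momInt (u : ℂ → ℂ) : Prop := Integrable (momDensity u)

/-- The momentum `P₂(u)`. -/
def P2 (u : ℂ → ℂ) : ℝ := (1 / 2) * ∫ z : ℂ, momDensity u z

/-- `(TW_c)(u) = 0`: the travelling wave equation `−ic∂₂u − Δu − (1−|u|²)u = 0`. -/
def TW (c : ℝ) (u : ℂ → ℂ) : Prop :=
  ∀ z : ℂ, -(Complex.I * (c : ℂ) * pd2 u z) - lap u z - ((1 - ‖u z‖ ^ 2 : ℝ) : ℂ) * u z = 0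

/-- `E_min(p)`. -/
def Emin (p : ℝ) : ℝ := sInf (Efun '' {u : ℂ → ℂ | memE u ∧ P2 u = p})

/-- Evenness in `x₁`: `u(−x₁, x₂) = u(x₁, x₂)`. -/
def evenX1 (u : ℂ → ℂ) : Prop := ∀ z : ℂ, u (-((starRingEnd ℂ) z)) = u z

/-- Quasi-minimizer hypotheses (with symmetry), momentum `p` and speed `c`. -/
def QuasiMin (Λ₀ : ℝ) (u : ℂ → ℂ) (p c : ℝ) : Prop :=
  memE u ∧ evenX1 u ∧ 0 < c ∧ TW c u ∧ momInt u ∧ P2 u = p ∧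
  Efun u ≤ 2 * Real.pi * Real.log p + Λ₀

/-- `V1` is the degree-one vortex with (increasing) modulus profile `ρ`. -/
def IsVortex (V1 : ℂ → ℂ) (ρ : ℝ → ℝ) : Prop :=
  ContDiff ℝ (⊤ : ℕ∞) V1 ∧
  (∀ z : ℂ, lap V1 z + V1 z * ((1 - ‖V1 z‖ ^ 2 : ℝ) : ℂ) = 0) ∧
  V1 0 = 0 ∧
  (∀ z : ℂ, z ≠ 0 → V1 z = ((ρ ‖z‖ : ℝ) : ℂ) * (z / (‖z‖ : ℂ))) ∧
  ρ 0 = 0 ∧ StrictMonoOn ρ (Set.Ici 0) ∧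
  (∀ r : ℝ, 0 ≤ r → 0 ≤ ρ r ∧ ρ r < 1) ∧
  Filter.Tendsto ρ Filter.atTop (nhds 1)

/-- The unit vector in the second coordinate direction of `ℝ^d` (zero if `d ≤ 1`). -/
def e2 (d : ℕ) : EuclideanSpace ℝ (Fin d) :=
  (WithLp.equiv 2 (Fin d → ℝ)).symm (fun i => if (i : ℕ) = 1 then 1 else 0)

/-- Laplacian on `ℝ^d`. -/
def lapE {d : ℕ} (U : EuclideanSpace ℝ (Fin d) → ℂ) (x : EuclideanSpace ℝ (Fin d)) : ℂ :=
  ∑ i : Fin d,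
    fderiv ℝ (fun y => fderiv ℝ U y (EuclideanSpace.single i 1)) x (EuclideanSpace.single i 1)

/-- Second derivative test: the second derivative at a local maximum is nonpositive. -/
lemma IsLocalMax.second_deriv_nonpos {g g' : ℝ → ℝ} {x₀ g'' : ℝ} (hmax : IsLocalMax g x₀)
    (hg : ∀ t, HasDerivAt g (g' t) t) (hg' : HasDerivAt g' g'' x₀) : g'' ≤ 0 := by
  by_contra! hpos
  have hd : deriv g = g' := funext fun t => (hg t).deriv
  have hmin : IsLocalMin g x₀ :=
    isLocalMin_of_deriv_deriv_pos (by rwa [hd, hg'.deriv]) hmax.deriv_eq_zero (hg x₀).continuousAt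
  have hconst : g =ᶠ[nhds x₀] fun _ => g x₀ := by
    filter_upwards [hmax, hmin] with t h1 h2 using le_antisymm h1 h2
  have hzero : deriv (deriv g) x₀ = 0 := by
    rw [hconst.deriv.deriv_eq]; simp
  rw [hd, hg'.deriv] at hzero
  exact hpos.ne' hzero

/-- One-dimensional second-order condition at a local maximum of `s² (‖u‖² - a)`, where
`s t = s₀ - 2 y t - t²`. -/
lemma second_order_weighted_normSq {u p : ℝ → ℂ} {q : ℂ} {s₀ y a : ℝ} (hs : 0 < s₀)
    (hu : ∀ t, HasDerivAt u (p t) t) (hp : HasDerivAt p q 0)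
    (hmax : IsLocalMax (fun t => (s₀ - 2 * y * t - t ^ 2) ^ 2 * (‖u t‖ ^ 2 - a)) 0) :
    s₀ ^ 2 * (2 * ‖p 0‖ ^ 2 + 2 * inner ℝ (u 0) q) ≤
      (24 * y ^ 2 + 4 * s₀) * (‖u 0‖ ^ 2 - a) := by
  have hσ (t : ℝ) : HasDerivAt (fun t => s₀ - 2 * y * t - t ^ 2) (-(2 * y) - 2 * t) t := by
    simpa using (((hasDerivAt_id t).const_mul (2 * y)).const_sub s₀).fun_sub
      ((hasDerivAt_id t).fun_pow 2)
  have hσ' : HasDerivAt (fun t : ℝ => -(2 * y) - 2 * t) (-2) 0 := by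
    simpa using ((hasDerivAt_id (0 : ℝ)).const_mul 2).const_sub (-(2 * y))
  have hσ2 (t : ℝ) : HasDerivAt (fun t => (s₀ - 2 * y * t - t ^ 2) ^ 2)
      (2 * (s₀ - 2 * y * t - t ^ 2) * (-(2 * y) - 2 * t)) t := by
    simpa using (hσ t).fun_pow 2
  have hV (t : ℝ) : HasDerivAt (fun t => ‖u t‖ ^ 2 - a) (2 * inner ℝ (u t) (p t)) t :=
    (hu t).norm_sq.sub_const a
  have hV' : HasDerivAt (fun t => 2 * inner ℝ (u t) (p t))
      (2 * (inner ℝ (u 0) q + inner ℝ (p 0) (p 0))) 0 :=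
    ((hu 0).inner ℝ hp).const_mul 2
  have hg (t : ℝ) := (hσ2 t).mul (hV t)
  have hg' := ((((hσ 0).const_mul 2).mul hσ').mul (hV 0)).add ((hσ2 0).mul hV')
  have h1 := hmax.hasDerivAt_eq_zero (hg 0)
  have h2 := hmax.second_deriv_nonpos hg hg'
  rw [real_inner_self_eq_norm_sq] at h2
  simp only [mul_zero, sub_zero, ne_eq, OfNat.ofNat_ne_zero, not_false_eq_true, zero_pow,
    Pi.mul_apply] at h1 h2
  have h3 : s₀ * (2 * inner ℝ (u 0) (p 0)) = 4 * y * (‖u 0‖ ^ 2 - a) := by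
    apply mul_left_cancel₀ hs.ne'
    linear_combination h1
  linear_combination h2 + 8 * y * h3

/-- Pointwise differential inequality for `‖U‖²`, as an algebraic statement. -/
lemma normSq_laplacian_lower_bound {c S : ℝ} {u D L : ℂ} (hS : ‖D‖ ^ 2 ≤ S)
    (heq : L + Complex.I * (c : ℂ) * D + u * ((1 - ‖u‖ ^ 2 : ℝ) : ℂ) = 0) :
    2 * ‖u‖ ^ 2 * (‖u‖ ^ 2 - (1 + c ^ 2 / 4)) ≤ 2 * S + 2 * inner ℝ u L := by
  have hL : L = -((c : ℝ) • (Complex.I * D)) - (1 - ‖u‖ ^ 2 : ℝ) • u := by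
    simp only [Complex.real_smul]
    linear_combination heq
  have hin : inner ℝ u L = -(c * inner ℝ u (Complex.I * D)) - (1 - ‖u‖ ^ 2) * ‖u‖ ^ 2 := by
    rw [hL, inner_sub_right, inner_neg_right, real_inner_smul_right, real_inner_smul_right,
      real_inner_self_eq_norm_sq]
  have hcs : c * inner ℝ u (Complex.I * D) ≤ |c| * (‖u‖ * ‖D‖) := by
    refine (le_abs_self _).trans ?_
    rw [abs_mul]
    gcongr
    simpa using abs_real_inner_le_norm u (Complex.I * D)
  rw [hin]
  nlinarith [sq_nonneg (2 * ‖D‖ - |c| * ‖u‖), sq_abs c]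

lemma norm_fderiv_e2_sq_le {d : ℕ} (A : EuclideanSpace ℝ (Fin d) →L[ℝ] ℂ) :
    ‖A (e2 d)‖ ^ 2 ≤ ∑ i : Fin d, ‖A (EuclideanSpace.single i 1)‖ ^ 2 := by
  by_cases h : 1 < d
  · have he : e2 d = EuclideanSpace.single (⟨1, h⟩ : Fin d) (1 : ℝ) := by
      ext i
      simp [e2, PiLp.single_apply, Fin.ext_iff]
    rw [he]
    exact Finset.single_le_sum
      (f := fun i : Fin d => ‖A (EuclideanSpace.single i 1)‖ ^ 2)
      (fun i _ => sq_nonneg _) (Finset.mem_univ _)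
  · have he : e2 d = 0 := by
      ext i
      have : (i : ℕ) ≠ 1 := by omega
      simp [e2, this]
    rw [he]
    simpa using Finset.sum_nonneg fun i (_ : i ∈ Finset.univ) =>
      sq_nonneg ‖A (EuclideanSpace.single i 1)‖

/-- Summed second-order condition at a local maximum of `(R² - ‖x - x₀‖²)² (‖U x‖² - a)`. -/
lemma laplacian_le_of_isLocalMax {d : ℕ} {U : EuclideanSpace ℝ (Fin d) → ℂ}
    (hsm : ContDiff ℝ (⊤ : ℕ∞) U) {x₀ z : EuclideanSpace ℝ (Fin d)} {R a : ℝ}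
    (hz : 0 < R ^ 2 - ‖z - x₀‖ ^ 2)
    (hmax : IsLocalMax (fun x => (R ^ 2 - ‖x - x₀‖ ^ 2) ^ 2 * (‖U x‖ ^ 2 - a)) z) :
    (R ^ 2 - ‖z - x₀‖ ^ 2) ^ 2 *
        (2 * ∑ i : Fin d, ‖fderiv ℝ U z (EuclideanSpace.single i 1)‖ ^ 2 +
          2 * inner ℝ (U z) (lapE U z)) ≤
      (24 * ‖z - x₀‖ ^ 2 + 4 * d * (R ^ 2 - ‖z - x₀‖ ^ 2)) * (‖U z‖ ^ 2 - a) := by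
  set s := R ^ 2 - ‖z - x₀‖ ^ 2 with hs
  have key (i : Fin d) : s ^ 2 * (2 * ‖fderiv ℝ U z (EuclideanSpace.single i 1)‖ ^ 2 +
      2 * inner ℝ (U z) (fderiv ℝ (fun y => fderiv ℝ U y (EuclideanSpace.single i 1)) z
        (EuclideanSpace.single i 1))) ≤
      (24 * (z - x₀) i ^ 2 + 4 * s) * (‖U z‖ ^ 2 - a) := by
    set e : EuclideanSpace ℝ (Fin d) := EuclideanSpace.single i 1 with he
    have hline (t : ℝ) : HasDerivAt (fun t : ℝ => z + t • e) e t := by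
      simpa using ((hasDerivAt_id t).smul_const e).const_add z
    have hD : ContDiff ℝ 1 (fun y => fderiv ℝ U y e) :=
      ((contDiff_infty.mp hsm 2).fderiv_right (m := 1) (by norm_num)).clm_apply contDiff_const
    have hu (t : ℝ) : HasDerivAt (fun t : ℝ => U (z + t • e)) (fderiv ℝ U (z + t • e) e) t :=
      ((hsm.differentiable (by simp)) _).hasFDerivAt.comp_hasDerivAt t (hline t)
    have hp : HasDerivAt (fun t : ℝ => fderiv ℝ U (z + t • e) e)
        (fderiv ℝ (fun y => fderiv ℝ U y e) (z + (0 : ℝ) • e) e) 0 :=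
      ((hD.differentiable (by simp)) _).hasFDerivAt.comp_hasDerivAt (0 : ℝ) (hline 0)
    have hcont : Filter.Tendsto (fun t : ℝ => z + t • e) (nhds 0) (nhds z) := by
      simpa using (hline 0).continuousAt.tendsto
    have hweight (t : ℝ) :
        R ^ 2 - ‖z + t • e - x₀‖ ^ 2 = s - 2 * (z - x₀) i * t - t ^ 2 := by
      have hin : inner ℝ (z - x₀) e = (z - x₀) i := by
        simp [he, EuclideanSpace.inner_single_right]
      rw [show z + t • e - x₀ = (z - x₀) + t • e by abel, norm_add_sq_real,
        real_inner_smul_right, hin, norm_smul, hs]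
      simp [he]
      ring
    have hm : IsLocalMax (fun t : ℝ =>
        (s - 2 * (z - x₀) i * t - t ^ 2) ^ 2 * (‖U (z + t • e)‖ ^ 2 - a)) 0 := by
      have := hcont.eventually hmax
      filter_upwards [this] with t ht
      rw [hweight t] at ht
      simpa using ht
    simpa using second_order_weighted_normSq hz hu hp hm
  have hsum := Finset.sum_le_sum fun i (_ : i ∈ (Finset.univ : Finset (Fin d))) => key i
  rw [← Finset.mul_sum, ← Finset.sum_mul, Finset.sum_add_distrib, Finset.sum_add_distrib,
    ← Finset.mul_sum, ← Finset.mul_sum, ← Finset.mul_sum, ← inner_sum] at hsum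
  have hn : ∑ i : Fin d, (z - x₀) i ^ 2 = ‖z - x₀‖ ^ 2 := by
    simp [EuclideanSpace.norm_sq_eq]
  rw [hn] at hsum
  simp only [Finset.sum_const, Finset.card_univ, Fintype.card_fin, nsmul_eq_mul] at hsum
  rw [show 4 * (d : ℝ) * s = d * (4 * s) by ring]
  exact hsum

/-- Keller–Osserman estimate on a ball of radius `R`. -/
lemma keller_osserman_estimate {d : ℕ} {c : ℝ} {U : EuclideanSpace ℝ (Fin d) → ℂ}
    (hsm : ContDiff ℝ (⊤ : ℕ∞) U)
    (heq : ∀ x : EuclideanSpace ℝ (Fin d),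
      lapE U x + Complex.I * (c : ℂ) * fderiv ℝ U x (e2 d) +
        U x * ((1 - ‖U x‖ ^ 2 : ℝ) : ℂ) = 0)
    (x₀ : EuclideanSpace ℝ (Fin d)) {R : ℝ} (hR : 0 < R) :
    R ^ 2 * (‖U x₀‖ ^ 2 - (1 + c ^ 2 / 4)) ≤ 12 + 2 * d := by
  set a := 1 + c ^ 2 / 4 with ha
  by_contra! hlt
  have hd : (0 : ℝ) ≤ d := d.cast_nonneg
  have hV₀ : 0 < ‖U x₀‖ ^ 2 - a := pos_of_mul_pos_right (by linarith) (sq_nonneg R)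
  have hc : Continuous (fun x => (R ^ 2 - ‖x - x₀‖ ^ 2) ^ 2 * (‖U x‖ ^ 2 - a)) := by
    have := hsm.continuous
    fun_prop
  obtain ⟨z, hzmem, hz⟩ := (isCompact_closedBall x₀ R).exists_isMaxOn
    ⟨x₀, mem_closedBall_self hR.le⟩ hc.continuousOn
  have hge := hz (mem_closedBall_self hR.le)
  simp only [Set.mem_ofPred_eq, sub_self, norm_zero, ne_eq, OfNat.ofNat_ne_zero,
    not_false_eq_true, zero_pow, sub_zero] at hge
  have hpos : 0 < (R ^ 2 - ‖z - x₀‖ ^ 2) ^ 2 * (‖U z‖ ^ 2 - a) :=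
    lt_of_lt_of_le (by positivity) hge
  have hV : 0 < ‖U z‖ ^ 2 - a := pos_of_mul_pos_right hpos (sq_nonneg _)
  have hle : ‖z - x₀‖ ≤ R := by simpa [dist_eq_norm] using hzmem
  have hne : ‖z - x₀‖ ≠ R := by
    intro h
    simp [h] at hpos
  have hltR : ‖z - x₀‖ < R := lt_of_le_of_ne hle hne
  have hs : 0 < R ^ 2 - ‖z - x₀‖ ^ 2 := by
    have := pow_lt_pow_left₀ hltR (norm_nonneg _) two_ne_zero
    linarith
  have hloc := hz.isLocalMax
    (mem_of_superset (isOpen_ball.mem_nhds (by simpa [dist_eq_norm] using hltR))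
      ball_subset_closedBall)
  have hup := laplacian_le_of_isLocalMax hsm hs hloc
  have hlow := normSq_laplacian_lower_bound (norm_fderiv_e2_sq_le (fderiv ℝ U z)) (heq z)
  have h1 : (R ^ 2 - ‖z - x₀‖ ^ 2) ^ 2 * (2 * ‖U z‖ ^ 2) ≤
      24 * ‖z - x₀‖ ^ 2 + 4 * d * (R ^ 2 - ‖z - x₀‖ ^ 2) := by
    refine le_of_mul_le_mul_right ?_ hV
    refine le_trans (le_of_eq ?_) ((mul_le_mul_of_nonneg_left hlow (sq_nonneg _)).trans hup)
    ring
  have h2 : (R ^ 2 - ‖z - x₀‖ ^ 2) ^ 2 * (‖U z‖ ^ 2 - a) ≤ (12 + 2 * d) * R ^ 2 := by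
    have h3 : 0 ≤ (R ^ 2 - ‖z - x₀‖ ^ 2) ^ 2 * a := by positivity
    have h4 : 0 ≤ (d : ℝ) * ‖z - x₀‖ ^ 2 := by positivity
    linarith
  have h5 : R ^ 2 * (12 + 2 * (d : ℝ)) < R ^ 2 * (R ^ 2 * (‖U x₀‖ ^ 2 - a)) :=
    mul_lt_mul_of_pos_left hlt (by positivity)
  linarith

/-- Farina's uniform `L^∞` bound. -/
theorem farina_bound (d : ℕ) (hd : 1 ≤ d) (c : ℝ) (U : EuclideanSpace ℝ (Fin d) → ℂ)
    (hsm : ContDiff ℝ (⊤ : ℕ∞) U)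
    (heq : ∀ x : EuclideanSpace ℝ (Fin d),
      lapE U x + Complex.I * (c : ℂ) * fderiv ℝ U x (e2 d) +
        U x * ((1 - ‖U x‖ ^ 2 : ℝ) : ℂ) = 0) :
    ∀ x : EuclideanSpace ℝ (Fin d), ‖U x‖ ≤ 1 + c ^ 2 / 4 := by
  intro x
  have hsq : ‖U x‖ ^ 2 ≤ 1 + c ^ 2 / 4 := by
    by_contra! hlt
    set V := ‖U x‖ ^ 2 - (1 + c ^ 2 / 4) with hVdef
    have hV : 0 < V := sub_pos.mpr hlt
    have hC : 0 < (13 + 2 * (d : ℝ)) / V := by positivity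
    have h := keller_osserman_estimate hsm heq x (Real.sqrt_pos.mpr hC)
    rw [Real.sq_sqrt hC.le, ← hVdef, div_mul_cancel₀ _ hV.ne'] at h
    linarith
  nlinarith [sq_nonneg c, sq_nonneg (‖U x‖ - 1)]
end
end

section
/- If u ∈ ℰ satisfies (TW_c)(u) = 0 for some c > 0, the momentum density of u is integrable, and 𝔭 := P₂(u) > 0, then c ≤ 2E(u)/𝔭. Moreover, for every Λ₀ > 0 there exists 𝔭₁(Λ₀) > 0 such that if in addition 𝔭 ≥ 𝔭₁(Λ₀) and E(u) ≤ 2π ln 𝔭 + Λ₀, then c ≤ 13 (ln 𝔭)/𝔭; in particular c ≤ 1/2 and ln 𝔭 ≤ 2|ln c|. -/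
open MeasureTheory Filter Metric

noncomputable section

/-- The first component of the field whose divergence is the travelling wave equation tested
against `∂₁u`. -/
def flux1 (c : ℝ) (u : ℂ → ℂ) (z : ℂ) : ℝ :=
  c / 2 * momDensity u z + (‖pd1 u z‖ ^ 2 - ‖pd2 u z‖ ^ 2) / 2 - (1 - ‖u z‖ ^ 2) ^ 2 / 4

/-- The second component of the field whose divergence is the travelling wave equation tested
against `∂₁u`. -/
def flux2 (c : ℝ) (u : ℂ → ℂ) (z : ℂ) : ℝ :=
  -(c / 2) * (Complex.I * pd1 u z * ((starRingEnd ℂ) (u z) - 1)).re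
    + (pd2 u z * (starRingEnd ℂ) (pd1 u z)).re

theorem ContDiff.fderiv_const_apply {u : ℂ → ℂ} (hu : ContDiff ℝ (⊤ : ℕ∞) u) (v : ℂ) :
    ContDiff ℝ (⊤ : ℕ∞) fun z => fderiv ℝ u z v :=
  (hu.fderiv_right (m := (⊤ : ℕ∞)) (by simp)).clm_apply contDiff_const

theorem contDiff_pd1 {u : ℂ → ℂ} (hu : ContDiff ℝ (⊤ : ℕ∞) u) : ContDiff ℝ (⊤ : ℕ∞) (pd1 u) :=
  hu.fderiv_const_apply 1

theorem contDiff_pd2 {u : ℂ → ℂ} (hu : ContDiff ℝ (⊤ : ℕ∞) u) : ContDiff ℝ (⊤ : ℕ∞) (pd2 u) :=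
  hu.fderiv_const_apply Complex.I

theorem fderiv_pd2_one {u : ℂ → ℂ} (hu : ContDiff ℝ (⊤ : ℕ∞) u) (z : ℂ) :
    fderiv ℝ (pd2 u) z 1 = fderiv ℝ (pd1 u) z Complex.I := by
  have hd : DifferentiableAt ℝ (fderiv ℝ u) z :=
    ((hu.fderiv_right (m := (⊤ : ℕ∞)) (by simp)).differentiable (by simp)) z
  have hs : IsSymmSndFDerivAt ℝ u z :=
    hu.contDiffAt.isSymmSndFDerivAt (by simpa using WithTop.coe_le_coe.2 (le_top (a := (2 : ℕ∞))))
  have key : ∀ v w : ℂ, fderiv ℝ (fun y => fderiv ℝ u y v) z w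
      = fderiv ℝ (fderiv ℝ u) z w v := by
    intro v w
    rw [fderiv_clm_apply hd (differentiableAt_const v)]
    simp
  exact (key _ _).trans ((hs _ _).trans (key _ _).symm)

theorem flux1_eq (c : ℝ) (u : ℂ → ℂ) (z : ℂ) :
    flux1 c u z = c / 2 * ((u z).im * (pd2 u z).re - ((u z).re - 1) * (pd2 u z).im)
      + ((pd1 u z).re ^ 2 + (pd1 u z).im ^ 2 - ((pd2 u z).re ^ 2 + (pd2 u z).im ^ 2)) / 2
      - (1 - ((u z).re ^ 2 + (u z).im ^ 2)) ^ 2 / 4 := by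
  simp only [flux1, momDensity, Complex.sq_norm, Complex.normSq_apply, Complex.mul_re,
    Complex.mul_im, Complex.sub_re, Complex.sub_im, Complex.conj_re, Complex.conj_im,
    Complex.I_re, Complex.I_im, Complex.one_re, Complex.one_im]
  ring

theorem flux2_eq (c : ℝ) (u : ℂ → ℂ) (z : ℂ) :
    flux2 c u z = -(c / 2) * ((u z).im * (pd1 u z).re - ((u z).re - 1) * (pd1 u z).im)
      + ((pd1 u z).re * (pd2 u z).re + (pd1 u z).im * (pd2 u z).im) := by
  simp only [flux2, Complex.mul_re,
    Complex.mul_im, Complex.sub_re, Complex.sub_im, Complex.conj_re, Complex.conj_im,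
    Complex.I_re, Complex.I_im, Complex.one_re, Complex.one_im]
  ring

theorem ContDiff.complex_re {n : WithTop ℕ∞} {f : ℂ → ℂ} (hf : ContDiff ℝ n f) :
    ContDiff ℝ n fun z => (f z).re :=
  Complex.reCLM.contDiff.comp hf

theorem ContDiff.complex_im {n : WithTop ℕ∞} {f : ℂ → ℂ} (hf : ContDiff ℝ n f) :
    ContDiff ℝ n fun z => (f z).im :=
  Complex.imCLM.contDiff.comp hf

theorem contDiff_flux1 (c : ℝ) {u : ℂ → ℂ} (hu : ContDiff ℝ (⊤ : ℕ∞) u) :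
    ContDiff ℝ (⊤ : ℕ∞) (flux1 c u) := by
  rw [funext (flux1_eq c u)]
  have h := hu.complex_re
  have h' := hu.complex_im
  have h1 := (contDiff_pd1 hu).complex_re
  have h1' := (contDiff_pd1 hu).complex_im
  have h2 := (contDiff_pd2 hu).complex_re
  have h2' := (contDiff_pd2 hu).complex_im
  fun_prop

theorem contDiff_flux2 (c : ℝ) {u : ℂ → ℂ} (hu : ContDiff ℝ (⊤ : ℕ∞) u) :
    ContDiff ℝ (⊤ : ℕ∞) (flux2 c u) := by
  rw [funext (flux2_eq c u)]
  have h := hu.complex_re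
  have h' := hu.complex_im
  have h1 := (contDiff_pd1 hu).complex_re
  have h1' := (contDiff_pd1 hu).complex_im
  have h2 := (contDiff_pd2 hu).complex_re
  have h2' := (contDiff_pd2 hu).complex_im
  fun_prop

theorem hasDerivAt_re_line {f : ℂ → ℂ} (hf : ContDiff ℝ (⊤ : ℕ∞) f) (z v : ℂ) :
    HasDerivAt (fun t : ℝ => (f (z + t • v)).re) (fderiv ℝ f z v).re 0 := by
  have h : HasLineDerivAt ℝ f (fderiv ℝ f z v) z v :=
    ((hf.differentiable (by simp)) z).hasFDerivAt.hasLineDerivAt v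
  exact Complex.reCLM.hasFDerivAt.comp_hasDerivAt (0 : ℝ) h

theorem hasDerivAt_im_line {f : ℂ → ℂ} (hf : ContDiff ℝ (⊤ : ℕ∞) f) (z v : ℂ) :
    HasDerivAt (fun t : ℝ => (f (z + t • v)).im) (fderiv ℝ f z v).im 0 := by
  have h : HasLineDerivAt ℝ f (fderiv ℝ f z v) z v :=
    ((hf.differentiable (by simp)) z).hasFDerivAt.hasLineDerivAt v
  exact Complex.imCLM.hasFDerivAt.comp_hasDerivAt (0 : ℝ) h

theorem fderiv_eq_of_hasDerivAt_line {f : ℂ → ℝ} {z v : ℂ} {d : ℝ}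
    (hf : DifferentiableAt ℝ f z) (h : HasDerivAt (fun t : ℝ => f (z + t • v)) d 0) :
    fderiv ℝ f z v = d :=
  (hf.hasFDerivAt.hasLineDerivAt v).unique h

/-- Solutions of the travelling wave equation have a divergence-free flux. -/
theorem div_flux_eq_zero {c : ℝ} {u : ℂ → ℂ} (hu : ContDiff ℝ (⊤ : ℕ∞) u) (h : TW c u) (z : ℂ) :
    fderiv ℝ (flux1 c u) z 1 + fderiv ℝ (flux2 c u) z Complex.I = 0 := by
  have hsym := fderiv_pd2_one hu z
  have tw := h z
  have twr := congrArg Complex.re tw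
  have twi := congrArg Complex.im tw
  simp only [lap, Complex.sub_re, Complex.neg_re, Complex.mul_re, Complex.add_re, Complex.sub_im,
    Complex.neg_im, Complex.mul_im, Complex.add_im, Complex.I_re, Complex.I_im, Complex.ofReal_re,
    Complex.ofReal_im, Complex.zero_re, Complex.zero_im, Complex.sq_norm,
    Complex.normSq_apply] at twr twi
  have lines : ∀ v, _ := fun v => And.intro (hasDerivAt_re_line hu z v)
    (And.intro (hasDerivAt_im_line hu z v)
    (And.intro (hasDerivAt_re_line (contDiff_pd1 hu) z v)
    (And.intro (hasDerivAt_im_line (contDiff_pd1 hu) z v)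
    (And.intro (hasDerivAt_re_line (contDiff_pd2 hu) z v)
      (hasDerivAt_im_line (contDiff_pd2 hu) z v)))))
  obtain ⟨a, b, a1, b1, a2, b2⟩ := lines 1
  have d1 := fderiv_eq_of_hasDerivAt_line ((contDiff_flux1 c hu).differentiable (by simp) z)
    ((((((b.fun_mul a2).fun_sub ((a.sub_const 1).fun_mul b2)).const_mul (c / 2)).fun_add
      ((((a1.fun_pow 2).fun_add (b1.fun_pow 2)).fun_sub
        ((a2.fun_pow 2).fun_add (b2.fun_pow 2))).div_const 2)).fun_sub
      (((((a.fun_pow 2).fun_add (b.fun_pow 2)).const_sub 1).fun_pow 2).div_const 4)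
      ).congr_of_eventuallyEq (.of_forall fun t => flux1_eq c u (z + t • 1)))
  obtain ⟨a, b, a1, b1, a2, b2⟩ := lines Complex.I
  have d2 := fderiv_eq_of_hasDerivAt_line ((contDiff_flux2 c hu).differentiable (by simp) z)
    (((((b.fun_mul a1).fun_sub ((a.sub_const 1).fun_mul b1)).const_mul (-(c / 2))).fun_add
      ((a1.fun_mul a2).fun_add (b1.fun_mul b2))
      ).congr_of_eventuallyEq (.of_forall fun t => flux2_eq c u (z + t • Complex.I)))
  rw [d1, d2, hsym]
  simp only [zero_smul, add_zero]
  simp only [show fderiv ℝ u z 1 = pd1 u z from rfl, show fderiv ℝ u z Complex.I = pd2 u z from rfl]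
  push_cast
  linear_combination (-(pd1 u z).re) * twr - (pd1 u z).im * twi

theorem integral_test_of_div_eq_zero {F G φ : ℂ → ℝ} (hF : ContDiff ℝ 1 F) (hG : ContDiff ℝ 1 G)
    (hφ : ContDiff ℝ 1 φ) (hc : HasCompactSupport φ)
    (hdiv : ∀ z, fderiv ℝ F z 1 + fderiv ℝ G z Complex.I = 0) :
    ∫ z, F z * fderiv ℝ φ z 1 = -∫ z, G z * fderiv ℝ φ z Complex.I := by
  have hcont : ∀ {f : ℂ → ℝ}, ContDiff ℝ 1 f → ∀ v, Continuous fun z => fderiv ℝ f z v :=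
    fun hf v => (hf.continuous_fderiv (by simp)).clm_apply continuous_const
  have hcs : ∀ v, HasCompactSupport fun z => fderiv ℝ φ z v := fun v => hc.fderiv_apply ℝ v
  have parts : ∀ {f : ℂ → ℝ}, ContDiff ℝ 1 f → ∀ v,
      ∫ z, f z * fderiv ℝ φ z v = -∫ z, fderiv ℝ f z v * φ z := fun {f} hf v =>
    integral_mul_fderiv_eq_neg_fderiv_mul_of_integrable
      (((hcont hf v).mul hφ.continuous).integrable_of_hasCompactSupport hc.mul_left)
      ((hf.continuous.mul (hcont hφ v)).integrable_of_hasCompactSupport (hcs v).mul_left)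
      ((hf.continuous.mul hφ.continuous).integrable_of_hasCompactSupport hc.mul_left)
      (fun x _ => hf.differentiable (by simp) x) (fun x _ => hφ.differentiable (by simp) x)
  rw [parts hF, parts hG, neg_neg, ← integral_neg]
  congr 1 with z
  linear_combination (-φ z) * hdiv z

/-- The rectangle `|x₁| ≤ r`, `|x₂| ≤ s`. -/
def box (r s : ℝ) : Set ℂ :=
  Complex.measurableEquivRealProd ⁻¹' (Set.Icc (-r) r ×ˢ Set.Icc (-s) s)

theorem measurableSet_box (r s : ℝ) : MeasurableSet (box r s) :=
  Complex.measurableEquivRealProd.measurable (measurableSet_Icc.prod measurableSet_Icc)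

theorem volume_box (r s : ℝ) :
    volume (box r s) = ENNReal.ofReal (2 * r) * ENNReal.ofReal (2 * s) := by
  rw [box, Complex.volume_preserving_equiv_real_prod.measure_preimage
    (measurableSet_Icc.prod measurableSet_Icc).nullMeasurableSet, Measure.volume_eq_prod,
    Measure.prod_prod, Real.volume_Icc, Real.volume_Icc]
  congr 2 <;> ring

/-- The rescaled truncation of the coordinate `x₁`. -/
def testFn (f a : ℝ → ℝ) (r s : ℝ) (z : ℂ) : ℝ := r * f (z.re / r) * a (z.im / s)

theorem contDiff_testFn {f a : ℝ → ℝ} (hf : ContDiff ℝ 1 f) (ha : ContDiff ℝ 1 a) (r s : ℝ) :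
    ContDiff ℝ 1 (testFn f a r s) := by
  have h1 : ContDiff ℝ 1 fun z : ℂ => z.re := Complex.reCLM.contDiff
  have h2 : ContDiff ℝ 1 fun z : ℂ => z.im := Complex.imCLM.contDiff
  exact (contDiff_const.mul (hf.comp (h1.div_const r))).mul (ha.comp (h2.div_const s))

theorem fderiv_testFn_one {f a : ℝ → ℝ} (hf : ContDiff ℝ 1 f) (ha : ContDiff ℝ 1 a) {r : ℝ}
    (hr : r ≠ 0) (s : ℝ) (z : ℂ) :
    fderiv ℝ (testFn f a r s) z 1 = deriv f (z.re / r) * a (z.im / s) := by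
  refine fderiv_eq_of_hasDerivAt_line ((contDiff_testFn hf ha r s).differentiable (by simp) z) ?_
  have h0 : HasDerivAt (fun t : ℝ => (z.re + t) / r) (1 / r) 0 :=
    ((hasDerivAt_id (0 : ℝ)).const_add z.re).div_const r
  have h1 : HasDerivAt (fun t : ℝ => f ((z.re + t) / r)) (deriv f (z.re / r) * (1 / r)) 0 := by
    refine HasDerivAt.comp (h₂ := f) (0 : ℝ) ?_ h0
    simpa using (hf.differentiable (by simp) (z.re / r)).hasDerivAt
  refine (((h1.const_mul r).mul_const (a (z.im / s))).congr_of_eventuallyEq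
    (.of_forall fun t => by simp [testFn])).congr_deriv ?_
  field_simp

theorem fderiv_testFn_I {f a : ℝ → ℝ} (hf : ContDiff ℝ 1 f) (ha : ContDiff ℝ 1 a) (r s : ℝ)
    (z : ℂ) :
    fderiv ℝ (testFn f a r s) z Complex.I = r / s * (f (z.re / r) * deriv a (z.im / s)) := by
  refine fderiv_eq_of_hasDerivAt_line ((contDiff_testFn hf ha r s).differentiable (by simp) z) ?_
  have h0 : HasDerivAt (fun t : ℝ => (z.im + t) / s) (1 / s) 0 :=
    ((hasDerivAt_id (0 : ℝ)).const_add z.im).div_const s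
  have h1 : HasDerivAt (fun t : ℝ => a ((z.im + t) / s)) (deriv a (z.im / s) * (1 / s)) 0 := by
    refine HasDerivAt.comp (h₂ := a) (0 : ℝ) ?_ h0
    simpa using (ha.differentiable (by simp) (z.im / s)).hasDerivAt
  refine ((h1.const_mul (r * f (z.re / r))).congr_of_eventuallyEq
    (.of_forall fun t => by simp [testFn])).congr_deriv ?_
  ring

theorem hasCompactSupport_testFn {f a : ℝ → ℝ} {R : ℝ} (hf : ∀ t, R < |t| → f t = 0)
    (ha : ∀ t, R < |t| → a t = 0) {r s : ℝ} (hr : 0 < r) (hs : 0 < s) :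
    HasCompactSupport (testFn f a r s) := by
  have hK : IsCompact (Set.Icc (-(R * r)) (R * r) ×ℂ Set.Icc (-(R * s)) (R * s)) :=
    isCompact_Icc.reProdIm isCompact_Icc
  refine HasCompactSupport.intro hK fun z hz => ?_
  rw [Complex.mem_reProdIm, Set.mem_Icc, Set.mem_Icc, ← abs_le, ← abs_le, not_and_or,
    not_le, not_le] at hz
  rcases hz with h | h
  · rw [testFn, hf, mul_zero, zero_mul]
    rwa [abs_div, abs_of_pos hr, lt_div_iff₀ hr]
  · rw [testFn, ha, mul_zero]
    rwa [abs_div, abs_of_pos hs, lt_div_iff₀ hs]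

/-- There is a smooth compactly supported function equal to `1` near the origin. -/
theorem exists_cutoff : ∃ (f a : ℝ → ℝ) (M : ℝ), ContDiff ℝ 1 f ∧ ContDiff ℝ 1 a ∧
    (∀ t, 2 < |t| → f t = 0) ∧ (∀ t, 2 < |t| → a t = 0) ∧ (∀ t, 2 < |t| → deriv a t = 0) ∧
    deriv f 0 = 1 ∧ a 0 = 1 ∧ (∀ t, |f t| ≤ M) ∧ (∀ t, |a t| ≤ M) ∧ (∀ t, |deriv f t| ≤ M) ∧
    ∀ t, |deriv a t| ≤ M := by
  let a : ContDiffBump (0 : ℝ) := ⟨1, 2, one_pos, one_lt_two⟩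
  have ha : ContDiff ℝ 1 a := a.contDiff
  let f : ℝ → ℝ := fun t => t * a t
  have hf : ContDiff ℝ 1 f := contDiff_id.mul ha
  have hac : HasCompactSupport a := a.hasCompactSupport
  have hfc : HasCompactSupport f := hac.mul_left
  obtain ⟨M₁, h₁⟩ := hfc.exists_bound_of_continuous hf.continuous
  obtain ⟨M₂, h₂⟩ := hac.exists_bound_of_continuous ha.continuous
  obtain ⟨M₃, h₃⟩ := hfc.deriv.exists_bound_of_continuous (hf.continuous_deriv le_rfl)
  obtain ⟨M₄, h₄⟩ := hac.deriv.exists_bound_of_continuous (ha.continuous_deriv le_rfl)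
  have ha0 : ∀ t, 2 < |t| → t ∉ tsupport a := by
    intro t ht
    rw [a.tsupport_eq, mem_closedBall, dist_zero_right, Real.norm_eq_abs, not_le]
    exact ht
  have a0 : a 0 = 1 := a.one_of_mem_closedBall (mem_closedBall_self a.rIn_pos.le)
  refine ⟨f, a, max (max M₁ M₂) (max M₃ M₄), hf, ha, ?_, ?_, ?_, ?_, a0,
    fun t => ?_, fun t => ?_, fun t => ?_, fun t => ?_⟩
  · intro t ht
    simp [f, image_eq_zero_of_notMem_tsupport (ha0 t ht)]
  · exact fun t ht => image_eq_zero_of_notMem_tsupport (ha0 t ht)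
  · exact fun t ht => Function.notMem_support.1 fun h => ha0 t ht (support_deriv_subset h)
  · refine HasDerivAt.deriv (((hasDerivAt_id (0 : ℝ)).fun_mul
      (ha.differentiable (by simp) 0).hasDerivAt).congr_deriv ?_)
    simp [a0]
  · exact (h₁ t).trans ((le_max_left _ _).trans (le_max_left _ _))
  · exact (h₂ t).trans ((le_max_right _ _).trans (le_max_left _ _))
  · exact (h₃ t).trans ((le_max_left _ _).trans (le_max_right _ _))
  · exact (h₄ t).trans ((le_max_right _ _).trans (le_max_right _ _))

/-- The first component of a divergence-free planar field has zero integral if it is integrable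
and the second component is not too large on average. -/
theorem integral_eq_zero_of_div_eq_zero {F G e : ℂ → ℝ} {K : ℝ} (hF : ContDiff ℝ 1 F)
    (hG : ContDiff ℝ 1 G) (hdiv : ∀ z, fderiv ℝ F z 1 + fderiv ℝ G z Complex.I = 0)
    (hFi : Integrable F) (hei : Integrable e) (he : ∀ z, 0 ≤ e z) (hK : 0 ≤ K)
    (hGe : ∀ s : ℝ, 1 ≤ s → ∀ z, |G z| ≤ K * (s * e z + 1 / s)) :
    ∫ z, F z = 0 := by
  obtain ⟨f, a, M, hf, ha, f0, a0, da0, hf1, ha1, fM, aM, dfM, daM⟩ := exists_cutoff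
  have hM : 0 ≤ M := (abs_nonneg _).trans (fM 0)
  have hdf : Continuous (deriv f) := hf.continuous_deriv le_rfl
  let r : ℕ → ℝ := fun n => (n : ℝ) + 1
  have hr : ∀ n, 1 ≤ r n := fun n => by simp [r]
  have hrpos : ∀ n, 0 < r n := fun n => one_pos.trans_le (hr n)
  have hrt : Tendsto r atTop atTop := tendsto_atTop_add_const_right _ _ tendsto_natCast_atTop_atTop
  have hdivt : ∀ x : ℝ, ∀ k : ℕ, k ≠ 0 → Tendsto (fun n => x / r n ^ k) atTop (nhds 0) :=
    fun x k hk => ((tendsto_pow_atTop hk).comp hrt).const_div_atTop x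
  let φ : ℕ → ℂ → ℝ := fun n => testFn f a (r n) (r n ^ 5)
  have lim1 : Tendsto (fun n => ∫ z, F z * fderiv ℝ (φ n) z 1) atTop (nhds (∫ z, F z)) := by
    refine tendsto_integral_of_dominated_convergence (fun z => |F z| * (M * M)) (fun n => ?_)
      (hFi.abs.mul_const _) (fun n => .of_forall fun z => ?_) (.of_forall fun z => ?_)
    · exact (hF.continuous.mul (((contDiff_testFn hf ha _ _).continuous_fderiv
        (by simp)).clm_apply continuous_const)).aestronglyMeasurable
    · rw [fderiv_testFn_one hf ha (hrpos n).ne', Real.norm_eq_abs, abs_mul, abs_mul]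
      gcongr
      · exact dfM _
      · exact aM _
    · have h1 : Tendsto (fun n => deriv f (z.re / r n)) atTop (nhds 1) := by
        rw [← hf1]
        exact (hdf.tendsto 0).comp (by simpa using hdivt z.re 1 one_ne_zero)
      have h2 : Tendsto (fun n => a (z.im / r n ^ 5)) atTop (nhds 1) := by
        rw [← ha1]
        exact (ha.continuous.tendsto 0).comp (hdivt z.im 5 (by simp))
      have h3 := (h1.mul h2).const_mul (F z)
      simp only [mul_one] at h3
      refine h3.congr fun n => ?_
      rw [fderiv_testFn_one hf ha (hrpos n).ne']
  have bound : ∀ n, ‖∫ z, F z * fderiv ℝ (φ n) z 1‖ ≤ M * M * K * ((∫ z, e z) + 16) / r n ^ 1 := by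
    intro n
    have hr0 := hrpos n
    rw [integral_test_of_div_eq_zero hF hG (contDiff_testFn hf ha _ _)
      (hasCompactSupport_testFn f0 a0 hr0 (pow_pos hr0 5)) hdiv, norm_neg]
    have hB := measurableSet_box (2 * r n) (2 * r n ^ 5)
    have hvol : volume (box (2 * r n) (2 * r n ^ 5)) ≠ ⊤ := by
      rw [volume_box]; exact ENNReal.mul_ne_top ENNReal.ofReal_ne_top ENNReal.ofReal_ne_top
    have hreal : volume.real (box (2 * r n) (2 * r n ^ 5)) = 16 * r n ^ 6 := by
      rw [Measure.real, volume_box, ENNReal.toReal_mul, ENNReal.toReal_ofReal (by positivity),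
        ENNReal.toReal_ofReal (by positivity)]
      ring
    have hind : Integrable ((box (2 * r n) (2 * r n ^ 5)).indicator fun _ => (1 : ℝ)) :=
      (integrable_indicator_iff hB).2 (integrableOn_const hvol)
    calc ‖∫ z, G z * fderiv ℝ (φ n) z Complex.I‖
        ≤ ∫ z, M * M * K * (e z / r n
            + (box (2 * r n) (2 * r n ^ 5)).indicator (fun _ => (1 : ℝ)) z / r n ^ 7) := by
          refine norm_integral_le_of_norm_le
            (((hei.div_const _).add (hind.div_const _)).const_mul _) (.of_forall fun z => ?_)
          rw [fderiv_testFn_I hf ha, Real.norm_eq_abs]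
          by_cases hz : z ∈ box (2 * r n) (2 * r n ^ 5)
          · rw [Set.indicator_of_mem hz, abs_mul, abs_mul, abs_mul]
            calc |G z| * (|r n / r n ^ 5| * (|f (z.re / r n)| * |deriv a (z.im / r n ^ 5)|))
                ≤ (K * (r n ^ 3 * e z + 1 / r n ^ 3)) * (|r n / r n ^ 5| * (M * M)) := by
                  gcongr
                  · exact (abs_nonneg _).trans (hGe _ (one_le_pow₀ (hr n)) z)
                  · exact hGe _ (one_le_pow₀ (hr n)) z
                  · exact fM _
                  · exact daM _
              _ = _ := by
                  rw [abs_of_pos (by positivity)]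
                  field_simp
          · have hzero : f (z.re / r n) * deriv a (z.im / r n ^ 5) = 0 := by
              rw [box, Set.mem_preimage, Complex.measurableEquivRealProd_apply, Set.mem_prod,
                Set.mem_Icc, Set.mem_Icc, ← abs_le, ← abs_le, not_and_or, not_le, not_le] at hz
              rcases hz with h | h
              · rw [f0, zero_mul]
                rwa [abs_div, abs_of_pos hr0, lt_div_iff₀ hr0]
              · rw [da0, mul_zero]
                rwa [abs_div, abs_of_pos (pow_pos hr0 5), lt_div_iff₀ (pow_pos hr0 5)]
            rw [hzero, mul_zero, mul_zero, abs_zero]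
            have := he z
            have : 0 ≤ (box (2 * r n) (2 * r n ^ 5)).indicator (fun _ => (1 : ℝ)) z :=
              Set.indicator_nonneg (fun _ _ => zero_le_one) z
            positivity
      _ = M * M * K * ((∫ z, e z) + 16) / r n ^ 1 := by
          rw [integral_const_mul, integral_add (hei.div_const _) (hind.div_const _),
            integral_div, integral_div, integral_indicator hB, setIntegral_const, hreal]
          simp only [smul_eq_mul]
          field_simp
  exact tendsto_nhds_unique lim1 (squeeze_zero_norm bound (hdivt _ 1 one_ne_zero))

theorem energyDensity_nonneg (u : ℂ → ℂ) (z : ℂ) : 0 ≤ energyDensity u z := by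
  unfold energyDensity gradSq
  positivity

theorem energyDensity_eq (u : ℂ → ℂ) (z : ℂ) :
    energyDensity u z = ((pd1 u z).re ^ 2 + (pd1 u z).im ^ 2
      + ((pd2 u z).re ^ 2 + (pd2 u z).im ^ 2)) / 2
      + (1 - ((u z).re ^ 2 + (u z).im ^ 2)) ^ 2 / 4 := by
  simp only [energyDensity, gradSq, Complex.sq_norm, Complex.normSq_apply]
  ring

theorem integrable_energyDensity {u : ℂ → ℂ} (hu : memE u) : Integrable (energyDensity u) := by
  have hc : Continuous (energyDensity u) := by
    have h := hu.1.continuous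
    have h1 := (contDiff_pd1 hu.1).continuous
    have h2 := (contDiff_pd2 hu.1).continuous
    unfold energyDensity gradSq
    fun_prop
  exact (lintegral_ofReal_ne_top_iff_integrable hc.aestronglyMeasurable
    (.of_forall (energyDensity_nonneg u))).1 hu.2.ne

theorem integral_energyDensity {u : ℂ → ℂ} (hu : memE u) : ∫ z, energyDensity u z = Efun u :=
  integral_eq_lintegral_of_nonneg_ae (.of_forall (energyDensity_nonneg u))
    (integrable_energyDensity hu).aestronglyMeasurable

theorem abs_flux1_sub_le (c : ℝ) (u : ℂ → ℂ) (z : ℂ) :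
    |flux1 c u z - c / 2 * momDensity u z| ≤ energyDensity u z := by
  rw [abs_le]
  unfold flux1 energyDensity gradSq
  constructor <;>
    nlinarith [sq_nonneg ‖pd1 u z‖, sq_nonneg ‖pd2 u z‖, sq_nonneg (1 - ‖u z‖ ^ 2)]

theorem abs_mul_sub_mul_le {a b x y s : ℝ} (hs : 0 < s) :
    |a * x - b * y| ≤ (s * (x ^ 2 + y ^ 2) + (a ^ 2 + b ^ 2) / s) / 2 := by
  have h : ∀ p q : ℝ, |p * q| ≤ (s * q ^ 2 + p ^ 2 / s) / 2 := by
    intro p q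
    have h1 : s * (|q| - |p| / s) ^ 2 = s * q ^ 2 + p ^ 2 / s - 2 * (|p| * |q|) := by
      field_simp
      rw [← sq_abs q, ← sq_abs p]
      ring
    rw [abs_mul]
    nlinarith [mul_nonneg hs.le (sq_nonneg (|q| - |p| / s))]
  calc |a * x - b * y| ≤ |a * x| + |b * y| := abs_sub _ _
    _ ≤ _ := add_le_add (h a x) (h b y)
    _ = _ := by ring

theorem abs_flux2_le {c : ℝ} (hc : 0 < c) (u : ℂ → ℂ) {s : ℝ} (hs : 1 ≤ s) (z : ℂ) :
    |flux2 c u z| ≤ (2 * c + 1) * (s * energyDensity u z + 1 / s) := by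
  have hs0 : 0 < s := one_pos.trans_le hs
  have he := energyDensity_nonneg u z
  rw [flux2_eq]
  rw [energyDensity_eq] at he ⊢
  generalize (u z).re = p, (u z).im = q, (pd1 u z).re = p₁, (pd1 u z).im = q₁,
    (pd2 u z).re = p₂, (pd2 u z).im = q₂ at he ⊢
  set e := (p₁ ^ 2 + q₁ ^ 2 + (p₂ ^ 2 + q₂ ^ 2)) / 2 + (1 - (p ^ 2 + q ^ 2)) ^ 2 / 4 with he'
  have h1 : |q * p₁ - (p - 1) * q₁| ≤ 3 * (s * e) + 5 / 2 * (1 / s) := by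
    refine (abs_mul_sub_mul_le hs0).trans ?_
    have g1 : p₁ ^ 2 + q₁ ^ 2 ≤ 2 * e := by
      rw [he']; nlinarith [sq_nonneg (1 - (p ^ 2 + q ^ 2)), sq_nonneg p₂, sq_nonneg q₂]
    have g2 : q ^ 2 + (p - 1) ^ 2 ≤ 5 + 4 * e := by
      rw [he']
      nlinarith [sq_nonneg (2 - (p ^ 2 + q ^ 2)), sq_nonneg (p + 1), sq_nonneg p₁, sq_nonneg q₁,
        sq_nonneg p₂, sq_nonneg q₂, sq_nonneg q]
    have g3 : e / s ≤ s * e := by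
      rw [div_le_iff₀ hs0]
      nlinarith [mul_le_mul hs hs zero_le_one hs0.le]
    calc (s * (p₁ ^ 2 + q₁ ^ 2) + (q ^ 2 + (p - 1) ^ 2) / s) / 2
        ≤ (s * (2 * e) + (5 + 4 * e) / s) / 2 := by gcongr
      _ = s * e + 2 * (e / s) + 5 / 2 * (1 / s) := by ring
      _ ≤ _ := by linarith
  have h2 : |p₁ * p₂ + q₁ * q₂| ≤ e := by
    rw [he', abs_le]
    constructor <;>
      nlinarith [sq_nonneg (1 - (p ^ 2 + q ^ 2)), sq_nonneg (p₁ + p₂), sq_nonneg (q₁ + q₂),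
        sq_nonneg (p₁ - p₂), sq_nonneg (q₁ - q₂)]
  have hse : e ≤ s * e := le_mul_of_one_le_left he hs
  have hs1 : 0 < 1 / s := by positivity
  calc |-(c / 2) * (q * p₁ - (p - 1) * q₁) + (p₁ * p₂ + q₁ * q₂)|
      ≤ |-(c / 2) * (q * p₁ - (p - 1) * q₁)| + |p₁ * p₂ + q₁ * q₂| := abs_add_le _ _
    _ = c / 2 * |q * p₁ - (p - 1) * q₁| + |p₁ * p₂ + q₁ * q₂| := by
      rw [abs_mul, abs_neg, abs_of_pos (half_pos hc)]
    _ ≤ c / 2 * (3 * (s * e) + 5 / 2 * (1 / s)) + s * e := by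
      gcongr
      exact h2.trans hse
    _ ≤ _ := by nlinarith [mul_nonneg hc.le (he.trans hse), mul_pos hc hs1]

/-- Pohozaev-type bound: the speed times the momentum is at most the energy. -/
theorem speed_mul_momentum_le_energy {c : ℝ} {u : ℂ → ℂ} (hc : 0 < c) (hu : memE u)
    (hm : momInt u) (h : TW c u) : c * P2 u ≤ Efun u := by
  have hei := integrable_energyDensity hu
  have hmi : Integrable fun z => c / 2 * momDensity u z := Integrable.const_mul hm _
  have hF : ContDiff ℝ 1 (flux1 c u) := (contDiff_flux1 c hu.1).of_le (by exact_mod_cast le_top)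
  have hG : ContDiff ℝ 1 (flux2 c u) := (contDiff_flux2 c hu.1).of_le (by exact_mod_cast le_top)
  have hFi : Integrable (flux1 c u) := by
    refine (hmi.abs.add hei).mono' hF.continuous.aestronglyMeasurable (.of_forall fun z => ?_)
    have h1 := abs_flux1_sub_le c u z
    have h2 := abs_sub_abs_le_abs_sub (flux1 c u z) (c / 2 * momDensity u z)
    simp only [Real.norm_eq_abs, Pi.add_apply]
    linarith
  have h0 := integral_eq_zero_of_div_eq_zero hF hG (div_flux_eq_zero hu.1 h) hFi hei
    (energyDensity_nonneg u) (by positivity) fun s hs z => abs_flux2_le hc u hs z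
  have hle : ∫ z, (c / 2 * momDensity u z - energyDensity u z) ≤ ∫ z, flux1 c u z :=
    integral_mono (hmi.sub hei) hFi fun z => by
      have := (abs_le.1 (abs_flux1_sub_le c u z)).1
      simp only
      linarith
  rw [h0, integral_sub hmi hei, integral_const_mul, integral_energyDensity hu] at hle
  unfold P2
  linarith

theorem eventually_log_bounds (Λ₀ : ℝ) : ∀ᶠ p : ℝ in atTop, 1 ≤ p ∧ 5 * Λ₀ ≤ Real.log p ∧
    26 * Real.log p ≤ √p := by
  have h := (isLittleO_log_rpow_atTop (half_pos one_pos)).bound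
    (show (0 : ℝ) < 1 / 26 by norm_num)
  filter_upwards [h, eventually_ge_atTop 1, Real.tendsto_log_atTop.eventually_ge_atTop (5 * Λ₀)]
    with p hp h1 hl
  refine ⟨h1, hl, ?_⟩
  rw [← Real.sqrt_eq_rpow, Real.norm_of_nonneg (Real.log_nonneg h1),
    Real.norm_of_nonneg (Real.sqrt_nonneg p)] at hp
  linarith

theorem le_half_and_log_le_of_le {c p : ℝ} (hc : 0 < c) (hp : 1 ≤ p)
    (hlog : 26 * Real.log p ≤ √p) (h : c ≤ 13 * Real.log p / p) :
    c ≤ 1 / 2 ∧ Real.log p ≤ 2 * |Real.log c| := by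
  have hp0 : 0 < p := one_pos.trans_le hp
  have hsq : 1 ≤ √p := Real.one_le_sqrt.2 hp
  have hs0 : 0 < √p := one_pos.trans_le hsq
  have hc1 : c ≤ 1 / 2 * (√p)⁻¹ := by
    refine h.trans ?_
    have hps : (√p)⁻¹ * p = √p := by
      rw [inv_mul_eq_div, Real.div_sqrt]
    rw [div_le_iff₀ hp0, mul_assoc, hps]
    linarith
  have hinv : (√p)⁻¹ ≤ 1 := inv_le_one_of_one_le₀ hsq
  refine ⟨by linarith, ?_⟩
  have hlc : Real.log c ≤ Real.log (√p)⁻¹ :=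
    Real.log_le_log hc (by linarith [inv_pos.2 hs0])
  rw [Real.log_inv, Real.log_sqrt hp0.le] at hlc
  linarith [neg_le_abs (Real.log c)]

/-- rough upper bounds on the speed of a travelling wave. -/
theorem speed_upper_bound :
    (∀ (c : ℝ) (u : ℂ → ℂ), 0 < c → memE u → momInt u → TW c u → 0 < P2 u →
      c ≤ 2 * Efun u / P2 u) ∧
    ∀ Λ₀ : ℝ, 0 < Λ₀ → ∃ p₁ : ℝ, 0 < p₁ ∧
      ∀ (c : ℝ) (u : ℂ → ℂ), 0 < c → memE u → momInt u → TW c u → 0 < P2 u →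
        p₁ ≤ P2 u → Efun u ≤ 2 * Real.pi * Real.log (P2 u) + Λ₀ →
        c ≤ 13 * Real.log (P2 u) / P2 u ∧ c ≤ 1 / 2 ∧
          Real.log (P2 u) ≤ 2 * |Real.log c| := by
  have main : ∀ (c : ℝ) (u : ℂ → ℂ), 0 < c → memE u → momInt u → TW c u → 0 < P2 u →
      c ≤ 2 * Efun u / P2 u := by
    intro c u hc hu hm h hP
    rw [le_div_iff₀ hP]
    have hE : 0 ≤ Efun u := ENNReal.toReal_nonneg
    linarith [speed_mul_momentum_le_energy hc hu hm h]
  refine ⟨main, fun Λ₀ _ => ?_⟩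
  obtain ⟨p₀, hp₀⟩ := eventually_atTop.1 (eventually_log_bounds Λ₀)
  refine ⟨max p₀ 1, by positivity, fun c u hc hu hm h hP hp hE => ?_⟩
  obtain ⟨h1, h2, h3⟩ := hp₀ (P2 u) ((le_max_left _ _).trans hp)
  have hc13 : c ≤ 13 * Real.log (P2 u) / P2 u := by
    refine (main c u hc hu hm h hP).trans (div_le_div_of_nonneg_right ?_ hP.le)
    nlinarith [Real.pi_lt_d2, Real.log_nonneg h1]
  exact ⟨hc13, le_half_and_log_le_of_le hc h1 h3 hc13⟩
end
end
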